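/- Let H and J be graphs each with at least one non-edge (a pair of distinct non-adjacent vertices). Then for every choice of non-negative integers r and k there is a graph G such that: (i) for every S ⊆ V(G) with |S| ≤ r, the induced subgraph G|S is {H,J}-split; and (ii) G has no ({H,J}, k)-partition. -/

import Mathlib

/-- A graph `G` contains a graph `H` if some induced subgraph of `G` is isomorphic to `H`. -/
def Contains {α β : Type} (G : SimpleGraph α) (H : SimpleGraph β) : Prop :=
  ∃ s : Set α, Nonempty ((G.induce s) ≃g H)

/-- `G` is `H`-free if `G` does not contain `H`. -/
def Free {α β : Type} (G : SimpleGraph α) (H : SimpleGraph β) : Prop := ¬ Contains G H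

/-- `G` is `{H₁,H₂}`-split if `V(G) = X₁ ∪ X₂` where `G|Xᵢ` is `Hᵢ`-free for `i = 1,2`. -/
def Split {γ α β : Type} (G : SimpleGraph γ) (H₁ : SimpleGraph α) (H₂ : SimpleGraph β) : Prop :=
  ∃ X₁ X₂ : Set γ, X₁ ∪ X₂ = Set.univ ∧ Free (G.induce X₁) H₁ ∧ Free (G.induce X₂) H₂


/-- The vertex type `γ` can be partitioned into `P` subsets each of which is a singleton
or satisfies the predicate `Ok`. -/
def HasPartition {γ : Type} (P : ℕ) (Ok : Set γ → Prop) : Prop :=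
  ∃ X : Fin P → Set γ, (⋃ i, X i) = Set.univ ∧
    (Pairwise fun i j => Disjoint (X i) (X j)) ∧
    ∀ i, (∃ v, X i = {v}) ∨ Ok (X i)

/-- A system of ordered hyperedges `inc e : ι → V` is sparse up to size `g` if every family of at
least two and at most `g` hyperedges has, besides any prescribed member, a leaf: a hyperedge
meeting the union of the other members in at most one vertex. -/
def SparseSystem {V E ι : Type} (g : ℕ) (inc : E → ι → V) : Prop :=
  ∀ F : Finset E, F.card ≤ g → ∀ e₀ ∈ F, (∃ e ∈ F, e ≠ e₀) → ∃ e ∈ F, e ≠ e₀ ∧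
    ∀ f ∈ F, ∀ f' ∈ F, f ≠ e → f' ≠ e → ∀ a b a' b',
      inc e a = inc f a' → inc e b = inc f' b' → a = b

/-- Every colouring of the vertices with `k` colours has a monochromatic hyperedge. -/
def VertexRamsey {V E ι : Type} (k : ℕ) (inc : E → ι → V) : Prop :=
  ∀ c : V → Fin k, ∃ e col, ∀ a, c (inc e a) = col

theorem exists_monochromatic_embedding (ι : Type) [Fintype ι] (k : ℕ)
    (c : Fin (k * Fintype.card ι + 1) → Fin k) :
    ∃ (e : ι ↪ Fin (k * Fintype.card ι + 1)) (col : Fin k), ∀ a, c (e a) = col := by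
  classical
  obtain ⟨col, hcol⟩ := Fintype.exists_lt_card_fiber_of_mul_lt_card (f := c)
    (n := Fintype.card ι) (by simp)
  have h : Fintype.card ι ≤ Fintype.card {x // c x = col} := by
    rw [Fintype.card_subtype]; exact hcol.le
  obtain ⟨e⟩ := Function.Embedding.nonempty_of_card_le h
  exact ⟨e.trans (Function.Embedding.subtype _), col, fun a => (e a).2⟩

/-- The amalgam of copies of a partite system indexed by the hyperedges of a second system, the
copies being glued along their parts `i`: the embedding of the copy indexed by `d`. -/
noncomputable def amalgamMap {V W D A : Type} (π : V → A) (i : A)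
    (glue : D → {v // π v = i} → W) (d : D) (v : V) : W ⊕ D × V :=
  open Classical in if h : π v = i then Sum.inl (glue d ⟨v, h⟩) else Sum.inr (d, v)

section Amalgam

variable {V W E D A ι : Type} {π : V → A} {i : A} {glue : D → {v // π v = i} → W}

theorem amalgamMap_of_eq {d : D} {v : V} (h : π v = i) :
    amalgamMap π i glue d v = Sum.inl (glue d ⟨v, h⟩) := by
  simp [amalgamMap, h]

theorem amalgamMap_of_ne {d : D} {v : V} (h : π v ≠ i) :
    amalgamMap π i glue d v = Sum.inr (d, v) := by
  simp [amalgamMap, h]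

theorem amalgamMap_injective (hglue : ∀ d, Function.Injective (glue d)) (d : D) :
    Function.Injective (amalgamMap π i glue d) := by
  intro v w h
  by_cases hv : π v = i <;> by_cases hw : π w = i
  · rw [amalgamMap_of_eq hv, amalgamMap_of_eq hw] at h
    simpa using hglue d (Sum.inl_injective h)
  · simp [amalgamMap_of_eq hv, amalgamMap_of_ne hw] at h
  · simp [amalgamMap_of_ne hv, amalgamMap_of_eq hw] at h
  · simpa [amalgamMap_of_ne hv, amalgamMap_of_ne hw] using h

theorem sumElim_amalgamMap (d : D) (v : V) :
    Sum.elim (fun _ => i) (fun p => π p.2) (amalgamMap π i glue d v) = π v := by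
  by_cases hv : π v = i
  · simp [amalgamMap_of_eq hv, hv]
  · simp [amalgamMap_of_ne hv]

theorem exists_glue_eq_of_amalgamMap_eq {d d' : D} (hd : d ≠ d') {v w : V}
    (h : amalgamMap π i glue d v = amalgamMap π i glue d' w) :
    ∃ (hv : π v = i) (hw : π w = i), glue d ⟨v, hv⟩ = glue d' ⟨w, hw⟩ := by
  by_cases hv : π v = i <;> by_cases hw : π w = i
  · rw [amalgamMap_of_eq hv, amalgamMap_of_eq hw] at h
    exact ⟨hv, hw, Sum.inl_injective h⟩
  · simp [amalgamMap_of_eq hv, amalgamMap_of_ne hw] at h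
  · simp [amalgamMap_of_ne hv, amalgamMap_of_eq hw] at h
  · simp [amalgamMap_of_ne hv, amalgamMap_of_ne hw, hd] at h

theorem SparseSystem.amalgam {g : ℕ} {inc : E → ι → V}
    (hglue : ∀ d, Function.Injective (glue d))
    (hπ : ∀ e, Function.Injective fun a => π (inc e a))
    (hG : SparseSystem g glue) (hP : SparseSystem (g + 1) inc) :
    SparseSystem (g + 1) fun (p : D × E) a => amalgamMap π i glue p.1 (inc p.2 a) := by
  classical
  rintro F hF ⟨d₀, e₀⟩ h₀ ⟨⟨d₁, e₁⟩, h₁, hne⟩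
  have hcard : ∀ d, (F.filter (fun p => p.1 = d)).card ≤ g + 1 := fun d =>
    (Finset.card_filter_le _ _).trans hF
  let fib : D → Finset E := fun d => (F.filter (fun p => p.1 = d)).image Prod.snd
  have hfib : ∀ d e, e ∈ fib d ↔ (d, e) ∈ F := by
    intro d e
    simp [fib]
  have hfibcard : ∀ d, (fib d).card ≤ g + 1 := fun d => Finset.card_image_le.trans (hcard d)
  by_cases hall : ∀ p ∈ F, p.1 = d₀
  · obtain rfl : d₁ = d₀ := hall _ h₁
    obtain ⟨e, he, hee, hleaf⟩ := hP (fib d₁) (hfibcard _) e₀ ((hfib _ _).2 h₀)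
      ⟨e₁, (hfib _ _).2 h₁, by rintro rfl; exact hne rfl⟩
    refine ⟨(d₁, e), (hfib _ _).1 he, by simpa using hee, ?_⟩
    rintro ⟨d, f⟩ hf ⟨d', f'⟩ hf' hfe hfe' a b a' b' hab hab'
    obtain rfl : d = d₁ := hall _ hf
    obtain rfl : d' = d := hall _ hf'
    exact hleaf f ((hfib _ _).2 hf) f' ((hfib _ _).2 hf') (by rintro rfl; exact hfe rfl)
      (by rintro rfl; exact hfe' rfl) a b a' b' (amalgamMap_injective hglue _ hab)
      (amalgamMap_injective hglue _ hab')
  · push Not at hall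
    obtain ⟨⟨d₂, e₂⟩, h₂, hd₂⟩ := hall
    by_cases hsingle : ∃ d e, (d, e) ∈ F ∧ d ≠ d₀ ∧ ∀ e', (d, e') ∈ F → e' = e
    · obtain ⟨d, e, he, hd, huniq⟩ := hsingle
      refine ⟨(d, e), he, fun h => hd (congrArg Prod.fst h), ?_⟩
      have key : ∀ p ∈ F, p ≠ (d, e) → ∀ a a', amalgamMap π i glue d (inc e a) =
          amalgamMap π i glue p.1 (inc p.2 a') → π (inc e a) = i := by
        rintro ⟨d', e'⟩ hp hpne a a' haa
        have hdd : d ≠ d' := by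
          rintro rfl
          exact hpne (by rw [huniq e' hp])
        exact (exists_glue_eq_of_amalgamMap_eq hdd haa).1
      intro f hf f' hf' hfe hfe' a b a' b' hab hab'
      exact hπ e ((key f hf hfe a a' hab).trans (key f' hf' hfe' b b' hab').symm)
    · push Not at hsingle
      have hlt : (F.image Prod.fst).card < F.card := by
        refine lt_of_le_of_ne Finset.card_image_le fun h => ?_
        have hinj := Finset.card_image_iff.1 h
        obtain ⟨e', he', hne'⟩ := hsingle d₂ e₂ h₂ hd₂
        exact hne' (congrArg Prod.snd (hinj he' h₂ rfl))
      obtain ⟨d, hdF, hd, hleaf⟩ := hG (F.image Prod.fst) (by omega) d₀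
        (Finset.mem_image_of_mem Prod.fst h₀) ⟨d₂, Finset.mem_image_of_mem Prod.fst h₂, hd₂⟩
      obtain ⟨⟨d', e⟩, he, rfl⟩ := Finset.mem_image.1 hdF
      dsimp only at hd hleaf
      obtain ⟨x, hx, hxs⟩ : ∃ x, (d', x) ∈ F ∧ ∀ f, (d', f) ∈ F → ∀ a, ∀ p ∈ F, p.1 ≠ d' →
          ∀ a', amalgamMap π i glue d' (inc f a) = amalgamMap π i glue p.1 (inc p.2 a') →
          ∃ b, inc f a = inc x b := by
        by_cases hsh : ∃ x, (d', x) ∈ F ∧ ∃ b, ∃ p ∈ F, p.1 ≠ d' ∧ ∃ b',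
          amalgamMap π i glue d' (inc x b) = amalgamMap π i glue p.1 (inc p.2 b')
        · obtain ⟨x, hx, b, q, hq, hqd, b', hb⟩ := hsh
          refine ⟨x, hx, fun f hf a p hp hpd a' ha => ⟨b, ?_⟩⟩
          obtain ⟨hv, hw, hvw⟩ := exists_glue_eq_of_amalgamMap_eq hpd.symm ha
          obtain ⟨hv', hw', hvw'⟩ := exists_glue_eq_of_amalgamMap_eq hqd.symm hb
          exact congrArg Subtype.val (hleaf p.1 (Finset.mem_image_of_mem Prod.fst hp) q.1
            (Finset.mem_image_of_mem Prod.fst hq) hpd hqd _ _ _ _ hvw hvw')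
        · exact ⟨e, he, fun f hf a p hp hpd a' ha => (hsh ⟨f, hf, a, p, hp, hpd, a', ha⟩).elim⟩
      obtain ⟨y, hy, hyx⟩ := hsingle d' x hx hd
      obtain ⟨f, hf, hfx, hfleaf⟩ := hP (fib d') (hfibcard _) x ((hfib _ _).2 hx)
        ⟨y, (hfib _ _).2 hy, hyx⟩
      have hfF := (hfib _ _).1 hf
      have key : ∀ p ∈ F, p ≠ (d', f) → ∀ a a', amalgamMap π i glue d' (inc f a) =
          amalgamMap π i glue p.1 (inc p.2 a') →
          ∃ f' ∈ fib d', f' ≠ f ∧ ∃ b, inc f a = inc f' b := by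
        rintro ⟨d₃, e₃⟩ hp hpne a a' haa
        by_cases hdd : d₃ = d'
        · subst hdd
          exact ⟨e₃, (hfib _ _).2 hp, by rintro rfl; exact hpne rfl, a',
            amalgamMap_injective hglue _ haa⟩
        · exact ⟨x, (hfib _ _).2 hx, hfx.symm, hxs f hfF a _ hp hdd a' haa⟩
      refine ⟨(d', f), hfF, fun h => hd (congrArg Prod.fst h), ?_⟩
      intro p hp p' hp' hpe hpe' a b a' b' hab hab'
      obtain ⟨f₁, hf₁, hne₁, b₁, hb₁⟩ := key p hp hpe a a' hab
      obtain ⟨f₂, hf₂, hne₂, b₂, hb₂⟩ := key p' hp' hpe' b b' hab'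
      exact hfleaf f₁ hf₁ f₂ hf₂ hne₁ hne₂ a b b₁ b₂ hb₁ hb₂

end Amalgam

/-- One can build partite sparse systems such that, for every colouring, one can choose hyperedges
over all transversals on which the colour of a vertex in a part in `S` depends on the part only. -/
theorem exists_partite_system {g k : ℕ}
    (ih : ∀ (ι : Type) [Fintype ι], ∃ (V E : Type) (_ : Fintype V) (_ : Fintype E)
      (inc : E → ι → V), (∀ e, Function.Injective (inc e)) ∧ SparseSystem g inc ∧
        VertexRamsey k inc)
    (ι A : Type) [Fintype ι] [Fintype A] [Nonempty (Fin k)] (S : Finset A) :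
    ∃ (V E : Type) (_ : Fintype V) (_ : Fintype E) (inc : E → ι → V) (π : V → A),
      (∀ e, Function.Injective fun a => π (inc e a)) ∧ SparseSystem (g + 1) inc ∧
      ∀ c : V → Fin k, ∃ col : A → Fin k, ∀ t : ι ↪ A, ∃ e, ∀ a,
        π (inc e a) = t a ∧ (t a ∈ S → c (inc e a) = col (t a)) := by
  classical
  induction S using Finset.induction_on with
  | empty =>
    refine ⟨(ι ↪ A) × ι, ι ↪ A, inferInstance, inferInstance, fun e a => (e, a),
      fun p => p.1 p.2, fun e => e.injective, ?_, ?_⟩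
    · rintro F - e₀ - ⟨e, he, hne⟩
      refine ⟨e, he, hne, fun f _ f' _ hf _ a b a' b' hab => ?_⟩
      exact (hf (congrArg Prod.fst hab).symm).elim
    · exact fun c => ⟨fun _ => Classical.arbitrary _, fun t => ⟨t, fun a => by simp⟩⟩
  | insert i S _ ihS =>
    obtain ⟨V, E, _, _, inc, π, hπ, hsp, hcol⟩ := ihS
    obtain ⟨W, D, _, _, glue, hglue, hsp', hram⟩ := ih {v // π v = i}
    refine ⟨W ⊕ D × V, D × E, inferInstance, inferInstance,
      fun p a => amalgamMap π i glue p.1 (inc p.2 a),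
      Sum.elim (fun _ => i) (fun p => π p.2), ?_, hsp'.amalgam hglue hπ hsp, ?_⟩
    · intro e
      simpa only [sumElim_amalgamMap] using hπ e.2
    · intro c
      obtain ⟨d, x, hx⟩ := hram fun w => c (Sum.inl w)
      obtain ⟨col, hc⟩ := hcol fun v => c (amalgamMap π i glue d v)
      refine ⟨Function.update col i x, fun t => ?_⟩
      obtain ⟨e, he⟩ := hc t
      refine ⟨(d, e), fun a => ⟨by simpa only [sumElim_amalgamMap] using (he a).1, fun ha => ?_⟩⟩
      by_cases hi : t a = i
      · rw [hi, Function.update_self]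
        exact (congrArg c (amalgamMap_of_eq ((he a).1.trans hi))).trans (hx _)
      · rw [Function.update_of_ne hi]
        exact (he a).2 ((Finset.mem_insert.1 ha).resolve_left hi)

theorem exists_sparse_vertexRamsey (g k : ℕ) [Nonempty (Fin k)] (ι : Type) [Fintype ι] :
    ∃ (V E : Type) (_ : Fintype V) (_ : Fintype E) (inc : E → ι → V),
      (∀ e, Function.Injective (inc e)) ∧ SparseSystem g inc ∧ VertexRamsey k inc := by
  classical
  induction g generalizing ι with
  | zero =>
    refine ⟨Fin (k * Fintype.card ι + 1), ι ↪ Fin (k * Fintype.card ι + 1), inferInstance,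
      inferInstance, fun e a => e a, fun e => e.injective, ?_,
      exists_monochromatic_embedding ι k⟩
    intro F hF e₀ h₀
    rw [Nat.le_zero, Finset.card_eq_zero] at hF
    simp [hF] at h₀
  | succ g ih =>
    obtain ⟨V, E, hV, hE, inc, π, hπ, hsp, hcol⟩ := exists_partite_system
      (fun ι' _ => ih ι') ι (Fin (k * Fintype.card ι + 1)) Finset.univ
    refine ⟨V, E, hV, hE, inc, fun e a b hab => hπ e (congrArg π hab), hsp, fun c => ?_⟩
    obtain ⟨col, hc⟩ := hcol c
    obtain ⟨t, x, hx⟩ := exists_monochromatic_embedding ι k col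
    obtain ⟨e, he⟩ := hc t
    exact ⟨e, x, fun a => ((he a).2 (Finset.mem_univ _)).trans (hx a)⟩

/-- A family of few hyperedges of a sparse system, each carrying a copy of an `n`-colourable
graph, can be properly coloured with `n` colours. -/
theorem SparseSystem.exists_coloring {V E ι : Type} {g n : ℕ} [Nonempty (Fin n)]
    {inc : E → ι → V} (hinj : ∀ e, Function.Injective (inc e)) (hsp : SparseSystem g inc)
    {K : SimpleGraph ι} (κ : K.Coloring (Fin n)) (F : Finset E) (hF : F.card ≤ g) :
    ∃ C : V → Fin n, ∀ e ∈ F, ∀ a b, K.Adj a b → C (inc e a) ≠ C (inc e b) := by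
  classical
  induction F using Finset.strongInduction with
  | H F ih =>
    rcases F.eq_empty_or_nonempty with rfl | ⟨e₀, h₀⟩
    · exact ⟨fun _ => Classical.arbitrary _, by simp⟩
    obtain ⟨e, he, hleaf⟩ : ∃ e ∈ F, ∀ f ∈ F, ∀ f' ∈ F, f ≠ e → f' ≠ e → ∀ a b a' b',
        inc e a = inc f a' → inc e b = inc f' b' → a = b := by
      by_cases h : ∃ e ∈ F, e ≠ e₀
      · obtain ⟨e, he, -, hl⟩ := hsp F hF e₀ h₀ h
        exact ⟨e, he, hl⟩
      · exact ⟨e₀, h₀, fun f hf _ _ hne => (h ⟨f, hf, hne⟩).elim⟩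
    obtain ⟨C, hC⟩ := ih (F.erase e) (Finset.erase_ssubset he)
      ((Finset.card_le_card (Finset.erase_subset _ _)).trans hF)
    obtain ⟨σ, hσ⟩ : ∃ σ : Equiv.Perm (Fin n), ∀ a, ∀ f ∈ F, f ≠ e → ∀ a', inc e a = inc f a' →
        σ (κ a) = C (inc e a) := by
      by_cases h : ∃ a, ∃ f ∈ F, f ≠ e ∧ ∃ a', inc e a = inc f a'
      · obtain ⟨a, f, hf, hfe, a', ha⟩ := h
        refine ⟨Equiv.swap (κ a) (C (inc e a)), fun b f' hf' hfe' b' hb => ?_⟩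
        obtain rfl := hleaf f hf f' hf' hfe hfe' a b a' b' ha hb
        exact Equiv.swap_apply_left _ _
      · exact ⟨1, fun a f hf hfe a' ha => (h ⟨a, f, hf, hfe, a', ha⟩).elim⟩
    let C' : V → Fin n := fun v => if h : ∃ a, inc e a = v then σ (κ h.choose) else C v
    have hC'e : ∀ a, C' (inc e a) = σ (κ a) := by
      intro a
      have h : ∃ b, inc e b = inc e a := ⟨a, rfl⟩
      simp only [C', dif_pos h, hinj e h.choose_spec]
    have hC'f : ∀ f ∈ F, f ≠ e → ∀ a, C' (inc f a) = C (inc f a) := by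
      intro f hf hfe a
      by_cases h : ∃ b, inc e b = inc f a
      · obtain ⟨b, hb⟩ := h
        rw [← hb, hC'e, hσ b f hf hfe a hb]
      · simp only [C', dif_neg h]
    refine ⟨C', fun f hf a b hab => ?_⟩
    by_cases hfe : f = e
    · subst hfe
      rw [hC'e, hC'e]
      exact fun h => κ.valid hab (σ.injective h)
    · rw [hC'f f hf hfe, hC'f f hf hfe]
      exact hC f (Finset.mem_erase.2 ⟨hfe, hf⟩) a b hab

/-- The graph obtained by placing a copy of `K` on every hyperedge. -/
def placeOn {V E ι : Type} (K : SimpleGraph ι) (inc : E → ι → V)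
    (hinj : ∀ e, Function.Injective (inc e)) : SimpleGraph V where
  Adj v w := ∃ e a b, K.Adj a b ∧ inc e a = v ∧ inc e b = w
  symm := ⟨by
    rintro v w ⟨e, a, b, hab, rfl, rfl⟩
    exact ⟨e, b, a, hab.symm, rfl, rfl⟩⟩
  loopless := ⟨by
    rintro v ⟨e, a, b, hab, ha, hb⟩
    exact hab.ne (hinj e (ha.trans hb.symm))⟩

theorem placeOn_adj_iff {V E ι : Type} {K : SimpleGraph ι} {inc : E → ι → V}
    {hinj : ∀ e, Function.Injective (inc e)} {g : ℕ} (hg : 2 ≤ g) (hsp : SparseSystem g inc)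
    (e : E) (a b : ι) : (placeOn K inc hinj).Adj (inc e a) (inc e b) ↔ K.Adj a b := by
  classical
  refine ⟨?_, fun h => ⟨e, a, b, h, rfl, rfl⟩⟩
  rintro ⟨f, a', b', hab, ha, hb⟩
  by_cases hfe : f = e
  · subst hfe
    rwa [← hinj f ha, ← hinj f hb]
  · obtain ⟨x, hx, hxe, hleaf⟩ := hsp {e, f} (Finset.card_le_two.trans hg) e (by simp)
      ⟨f, by simp, hfe⟩
    obtain rfl : x = f := by simpa [hxe] using hx
    exact (hab.ne (hleaf e (by simp) e (by simp) hxe.symm hxe.symm _ _ _ _ ha hb)).elim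

theorem placeOn_induce_colorable {V E ι : Type} [Finite V] {K : SimpleGraph ι} {inc : E → ι → V}
    {hinj : ∀ e, Function.Injective (inc e)} {g n r : ℕ} (hn : 0 < n) (hg : r * r ≤ g)
    (hsp : SparseSystem g inc) (hK : K.Colorable n) (S : Set V) (hS : S.ncard ≤ r) :
    ((placeOn K inc hinj).induce S).Colorable n := by
  classical
  have : Nonempty (Fin n) := ⟨⟨0, hn⟩⟩
  let T : Finset V := S.toFinite.toFinset
  have hT : T.card ≤ r := by rwa [← Set.ncard_eq_toFinset_card]
  let P : Finset (V × V) := (T ×ˢ T).filter fun p => (placeOn K inc hinj).Adj p.1 p.2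
  have hP : ∀ p : P, ∃ e a b, K.Adj a b ∧ inc e a = p.1.1 ∧ inc e b = p.1.2 := fun p =>
    (Finset.mem_filter.1 p.2).2
  choose edge x y hxy hx hy using hP
  have hcard : (P.attach.image edge).card ≤ g := by
    refine Finset.card_image_le.trans ?_
    rw [Finset.card_attach]
    refine (Finset.card_filter_le _ _).trans ?_
    rw [Finset.card_product]
    exact (Nat.mul_le_mul hT hT).trans hg
  obtain ⟨C, hC⟩ := hsp.exists_coloring hinj hK.some _ hcard
  refine ⟨SimpleGraph.Coloring.mk (fun v => C v.1) ?_⟩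
  intro v w hvw
  have hp : (v.1, w.1) ∈ P := by
    simp only [P, T, Finset.mem_filter, Finset.mem_product, Set.Finite.mem_toFinset]
    exact ⟨⟨v.2, w.2⟩, hvw⟩
  have := hC (edge ⟨_, hp⟩) (Finset.mem_image_of_mem _ (Finset.mem_attach _ _)) _ _ (hxy ⟨_, hp⟩)
  rwa [hx, hy] at this

theorem contains_iff_nonempty_embedding {α β : Type} {G : SimpleGraph α} {H : SimpleGraph β} :
    Contains G H ↔ Nonempty (H ↪g G) := by
  constructor
  · rintro ⟨s, ⟨φ⟩⟩
    exact ⟨(SimpleGraph.Embedding.induce s).comp φ.symm.toEmbedding⟩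
  · rintro ⟨φ⟩
    exact ⟨Set.range φ, ⟨φ.isoInduceRange.symm⟩⟩

theorem contains_induce_of_adj_iff {α γ : Type} {G : SimpleGraph γ} {H : SimpleGraph α}
    {X : Set γ} {φ : α → γ} (hφ : Function.Injective φ) (hX : ∀ a, φ a ∈ X)
    (hadj : ∀ a b, G.Adj (φ a) (φ b) ↔ H.Adj a b) : Contains (G.induce X) H :=
  contains_iff_nonempty_embedding.2
    ⟨⟨⟨fun a => ⟨φ a, hX a⟩, fun _ _ h => hφ (congrArg Subtype.val h)⟩, hadj _ _⟩⟩

theorem Split.symm {γ α β : Type} {G : SimpleGraph γ} {H : SimpleGraph α} {J : SimpleGraph β}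
    (h : Split G H J) : Split G J H := by
  obtain ⟨X, Y, hXY, hX, hY⟩ := h
  exact ⟨Y, X, by rwa [Set.union_comm], hY, hX⟩

/-- If the complement of `G` is `(m + 1)`-colourable but the complement of `H` is not
`m`-colourable, then removing a colour class from `G` leaves an `H`-free graph. -/
theorem split_of_compl_colorable {γ α β : Type} {G : SimpleGraph γ} {H : SimpleGraph α}
    {J : SimpleGraph β} {m : ℕ} (hG : Gᶜ.Colorable (m + 1)) (hH : ¬ Hᶜ.Colorable m)
    (hJ : ∃ u v, u ≠ v ∧ ¬ J.Adj u v) : Split G H J := by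
  obtain ⟨C⟩ := hG
  refine ⟨{v | C v ≠ Fin.last m}, {v | C v = Fin.last m}, ?_, ?_, ?_⟩
  · ext v
    simp [em']
  · intro h
    obtain ⟨φ⟩ := contains_iff_nonempty_embedding.1 h
    refine hH ⟨SimpleGraph.Coloring.mk (fun a => (C (φ a).1).castPred (φ a).2) ?_⟩
    intro a b hab heq
    have hadj : Gᶜ.Adj (φ a).1 (φ b).1 := by
      refine ⟨fun h => hab.1 (φ.injective (Subtype.ext h)), fun h => hab.2 ?_⟩
      exact φ.map_adj_iff.1 h
    exact C.valid hadj (Fin.castPred_inj.1 heq)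
  · intro h
    obtain ⟨φ⟩ := contains_iff_nonempty_embedding.1 h
    obtain ⟨u, v, huv, hadj⟩ := hJ
    have hadj' : Gᶜ.Adj (φ u).1 (φ v).1 := by
      refine ⟨fun h => huv (φ.injective (Subtype.ext h)), fun h => hadj ?_⟩
      exact φ.map_adj_iff.1 h
    exact C.valid hadj' ((φ u).2.trans (φ v).2.symm)

/-- Let `H` and `J` be graphs each with at least one non-edge. Then for every choice of
non-negative integers `r` and `k` there is a graph `G` such that every induced subgraph
of `G` on at most `r` vertices is `{H,J}`-split, but `G` has no `({H,J},k)`-partition. -/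
theorem stmt8 {α β : Type} [Fintype α] [Fintype β]
    (H : SimpleGraph α) (J : SimpleGraph β)
    (hH : ∃ u v, u ≠ v ∧ ¬ H.Adj u v) (hJ : ∃ u v, u ≠ v ∧ ¬ J.Adj u v) (r k : ℕ) :
    ∃ (γ : Type) (_ : Fintype γ) (G : SimpleGraph γ),
      (∀ S : Set γ, S.ncard ≤ r → Split (G.induce S) H J) ∧
      ¬ HasPartition k (fun X : Set γ => Free (G.induce X) H ∨ Free (G.induce X) J) := by
  classical
  obtain ⟨u, v, huv, -⟩ := id hH
  let K : SimpleGraph (α ⊕ β) := Hᶜ ⊕g Jᶜ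
  obtain ⟨m, hK, hm⟩ : ∃ m, K.Colorable (m + 1) ∧ (¬ Hᶜ.Colorable m ∨ ¬ Jᶜ.Colorable m) := by
    have hex : ∃ n, K.Colorable n := ⟨_, K.colorable_of_fintype⟩
    have hpos : Nat.find hex ≠ 0 := by
      intro h0
      have h := Nat.find_spec hex
      rw [h0] at h
      exact (h.some (Sum.inl u)).elim0
    obtain ⟨m, hm⟩ := Nat.exists_eq_succ_of_ne_zero hpos
    refine ⟨m, by simpa [hm] using Nat.find_spec hex, ?_⟩
    by_contra! h
    refine Nat.find_min hex (m := m) (by omega) ?_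
    exact ⟨SimpleGraph.Coloring.sum h.1.some h.2.some⟩
  obtain ⟨V, E, hV, -, inc, hinj, hsp, hram⟩ :=
    exists_sparse_vertexRamsey (r * r + 2) (k + 1) (α ⊕ β)
  refine ⟨V, hV, (placeOn K inc hinj)ᶜ, fun S hS => ?_, ?_⟩
  · have hcol := placeOn_induce_colorable (hinj := hinj) m.succ_pos (Nat.le_add_right _ 2) hsp hK
      S hS
    have hcompl : ((placeOn K inc hinj)ᶜ.induce S)ᶜ = (placeOn K inc hinj).induce S := by
      ext a b
      have := fun h : (placeOn K inc hinj).Adj a b => h.ne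
      simp [Subtype.ext_iff]
      tauto
    rw [← hcompl] at hcol
    rcases hm with hm | hm
    · exact split_of_compl_colorable hcol hm hJ
    · exact (split_of_compl_colorable hcol hm hH).symm
  · rintro ⟨X, hX, -, hOk⟩
    have hmem : ∀ v, ∃ i, v ∈ X i := fun v => Set.mem_iUnion.1 (hX ▸ Set.mem_univ v)
    choose c hc using hmem
    obtain ⟨e, i', hi'⟩ := hram fun v => (c v).castSucc
    obtain ⟨i, hi⟩ : ∃ i, ∀ a, inc e a ∈ X i := by
      refine ⟨c (inc e (Sum.inl u)), fun a => ?_⟩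
      rw [← Fin.castSucc_injective _ ((hi' a).trans (hi' (Sum.inl u)).symm)]
      exact hc _
    have hadj := placeOn_adj_iff (K := K) (hinj := hinj) (Nat.le_add_left 2 _) hsp e
    rcases hOk i with ⟨w, hw⟩ | hfree | hfree
    · have h₁ := hi (Sum.inl u)
      have h₂ := hi (Sum.inl v)
      rw [hw] at h₁ h₂
      exact huv (Sum.inl_injective (hinj e (h₁.trans h₂.symm)))
    · refine hfree (contains_induce_of_adj_iff ((hinj e).comp Sum.inl_injective) (fun a => hi _)
        fun a b => ?_)
      have := fun h : H.Adj a b => h.ne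
      simp only [Function.comp_apply, SimpleGraph.compl_adj, hadj, K, SimpleGraph.sum_adj_inl,
        ne_eq, (hinj e).eq_iff, Sum.inl.injEq]
      tauto
    · refine hfree (contains_induce_of_adj_iff ((hinj e).comp Sum.inr_injective) (fun a => hi _)
        fun a b => ?_)
      have := fun h : J.Adj a b => h.ne
      simp only [Function.comp_apply, SimpleGraph.compl_adj, hadj, K, SimpleGraph.sum_adj_inr,
        ne_eq, (hinj e).eq_iff, Sum.inr.injEq]
      tauto
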